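/- Let θ = (Δ,Γ,r,m) and θ' be extended configurations with θ' ⪯ θ. Then there exists an extended configuration θ̃ = (Δ̃,Γ̃,r̃,m̃) such that: (1) θ' reaches θ̃ by n applications of →inc for some n ≤ 3·2^{|𝒮|}; (2) θ̃ ⪯ θ; and (3) for every χ ⊆ 𝒮, if strictly more than 2 data values d satisfy Γ(d) = χ, then strictly more than 2 data values d satisfy Γ̃(d) = χ. -/

import Mathlib

namespace ECBUDA

/-- Evaluation of a nonempty word under the semigroup homomorphism determined
by the letter map `h` (and `none` on the empty word). -/
def hword {A B S : Type} [Mul S] (h : A × B → S) : List (A × B) → Option S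
  | [] => none
  | c :: w => some (w.foldl (fun s x => s * h x) (h c))

/-- (NF1): the homomorphism takes distinct values on words of length one:
`h(w) = h(c)` iff `w = c`. -/
def NF1 {A B S : Type} [Mul S] (h : A × B → S) : Prop :=
  ∀ (w : List (A × B)) (c : A × B), hword h w = some (h c) ↔ w = [c]

/-- Basic tests allowed in normal form (NF2): state tests, `⟨μ⟩^=`, `⟨μ⟩^≠`
and `root`. -/
inductive NTest (Q S : Type) : Type where
  | state : Q → NTest Q S
  | deq : S → NTest Q S
  | dneq : S → NTest Q S
  | root : NTest Q S

/-- Basic actions. -/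
inductive NAct (Q : Type) : Type where
  | accept : NAct Q
  | keep : Q → NAct Q
  | store : Q → NAct Q
  | guess : Q → NAct Q
  | univ : Q → NAct Q

/-- The set `TA`: possibly negated basic tests (the Boolean flag `true` marks
negation), basic actions, and the three symbols `⊤`, `⊤g`, `⊥`. -/
inductive TA (Q S : Type) : Type where
  | test : Bool → NTest Q S → TA Q S
  | act : NAct Q → TA Q S
  | top : TA Q S
  | topg : TA Q S
  | bot : TA Q S

/-- A transition of the automaton in normal form: a conjunction of possibly
negated basic tests with a conjunction of basic actions. -/
abbrev NTrans (Q S : Type) : Type := List (Bool × NTest Q S) × List (NAct Q)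

/-- An extended configuration `(Δ, Γ, r, m)`: `Δ` a finite set of threads,
`Γ` a finite set of pairs (semigroup element, data value) containing exactly
one pair whose first component is the image under `h` of a letter (this letter
is the label of the configuration and the associated data value its data
value), and Booleans `r` (root) and `m` (merge). -/
structure EConf (A B Q S : Type) (D : Type) (h : A × B → S) : Type where
  Δ : Set (Q × TA Q S × D)
  Γ : Set (S × D)
  r : Bool
  m : Bool
  finΔ : Δ.Finite
  finΓ : Γ.Finite
  uniq : ∃! x : S × D, x ∈ Γ ∧ ∃ c : A × B, x.1 = h c

variable {A B Q S D : Type} {h : A × B → S}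

/-- `Δ(d)`: the threads carrying the data value `d`. -/
def EConf.dfun (θ : EConf A B Q S D h) (d : D) : Set (Q × TA Q S) :=
  {qa | (qa.1, qa.2, d) ∈ θ.Δ}

/-- `Γ(d)`: the semigroup elements of downward paths leading to `d`. -/
def EConf.gfun (θ : EConf A B Q S D h) (d : D) : Set S :=
  {μ | (μ, d) ∈ θ.Γ}

/-- The data values occurring in the extended configuration. -/
def EConf.dataset (θ : EConf A B Q S D h) : Set D :=
  {d | (∃ qa : Q × TA Q S, (qa.1, qa.2, d) ∈ θ.Δ) ∨ ∃ μ : S, (μ, d) ∈ θ.Γ}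

/-- The unique pair of `Γ` recording the label and the data value of the root. -/
def EConf.rootInfo (θ : EConf A B Q S D h) : Set (S × D) :=
  {x ∈ θ.Γ | ∃ c : A × B, x.1 = h c}

/-- The set of data values of the root pair (a singleton). -/
def EConf.rootData (θ : EConf A B Q S D h) : Set D :=
  {d | ∃ μ : S, (μ, d) ∈ θ.Γ ∧ ∃ c : A × B, μ = h c}

/-- The profile `(A₀, A₁, r, m)` of an extended configuration: `Aᵢ` is the set
of those `χ ⊆ S` such that exactly `i` data values `d` satisfy `Γ(d) = χ`. -/
def EConf.profile (θ : EConf A B Q S D h) :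
    Set (Set S) × Set (Set S) × Bool × Bool :=
  ({χ | {d | θ.gfun d = χ}.encard = 0},
   {χ | {d | θ.gfun d = χ}.encard = 1}, θ.r, θ.m)

/-- `θ₁ ⪯_f θ₂`. -/
def pleF (f : D → D) (θ₁ θ₂ : EConf A B Q S D h) : Prop :=
  θ₁.profile = θ₂.profile ∧ θ₁.dataset ⊆ Set.range f ∧
  ∀ d : D, θ₁.dfun (f d) ⊆ θ₂.dfun d ∧ θ₁.gfun (f d) = θ₂.gfun d

/-- The well-quasi-order `⪯` on extended configurations. -/
def ple (θ₁ θ₂ : EConf A B Q S D h) : Prop :=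
  ∃ f : D → D, pleF f θ₁ θ₂

/-- `θ₁ ∼ θ₂`: equal up to a bijection of the data values. -/
def simEquiv (θ₁ θ₂ : EConf A B Q S D h) : Prop :=
  ∃ g : D ≃ D,
    θ₂.Δ = {x | (x.1, x.2.1, g.symm x.2.2) ∈ θ₁.Δ} ∧
    θ₂.Γ = {x | (x.1, g.symm x.2) ∈ θ₁.Γ} ∧
    θ₂.r = θ₁.r ∧ θ₂.m = θ₁.m

/-- The closure of a set of extended configurations under `∼`. -/
def simClose (Θ : Set (EConf A B Q S D h)) : Set (EConf A B Q S D h) :=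
  {θ | ∃ θ' ∈ Θ, simEquiv θ θ'}

/-- `Θ ≤min Θ'`: every member of `Θ'` is minorized by a member of `Θ`. -/
def leMin (Θ Θ' : Set (EConf A B Q S D h)) : Prop :=
  ∀ θ' ∈ Θ', ∃ θ ∈ Θ, ple θ θ'

/-- Satisfaction of a basic test by the thread `(q, d)` in an extended
configuration. -/
def ntestHolds (θ : EConf A B Q S D h) (q : Q) (d : D) : NTest Q S → Prop
  | .state p => q = p
  | .deq μ => (μ, d) ∈ θ.Γ
  | .dneq μ => ∃ e : D, e ≠ d ∧ (μ, e) ∈ θ.Γ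
  | .root => θ.r = true

def taTestHolds (θ : EConf A B Q S D h) (q : Q) (d : D) (neg : Bool)
    (t : NTest Q S) : Prop :=
  if neg then ¬ ntestHolds θ q d t else ntestHolds θ q d t

/-- The tests and actions occurring in a transition, as elements of `TA`. -/
def taSet (tr : NTrans Q S) : Set (TA Q S) :=
  {x | (∃ nt ∈ tr.1, x = TA.test nt.1 nt.2) ∨ ∃ a ∈ tr.2, x = TA.act a}

/-- The ε-transitions of the transition system: they keep `Γ`, `r` (hence the
label and data value), require the merge flag to be false, and rewrite one
thread of `Δ`. -/
def epsStep (δ : List (NTrans Q S)) (θ₁ θ₂ : EConf A B Q S D h) : Prop :=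
  θ₁.m = false ∧ θ₂.m = false ∧ θ₂.r = θ₁.r ∧ θ₂.Γ = θ₁.Γ ∧
  ∃ (q : Q) (d : D),
    -- applying a transition of δ to a ⊥-thread
    ((∃ tr ∈ δ, (q, TA.bot, d) ∈ θ₁.Δ ∧
        θ₂.Δ = (θ₁.Δ \ {(q, TA.bot, d)}) ∪
          {x | x.1 = q ∧ x.2.2 = d ∧ x.2.1 ∈ taSet tr}) ∨
    -- univ
    (∃ p : Q, (q, TA.act (NAct.univ p), d) ∈ θ₁.Δ ∧
        θ₂.Δ = (θ₁.Δ \ {(q, TA.act (NAct.univ p), d)}) ∪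
          {x | x.1 = p ∧ x.2.1 = TA.top ∧ ∃ μ : S, (μ, x.2.2) ∈ θ₁.Γ}) ∨
    -- guess
    (∃ (p : Q) (d' : D), (q, TA.act (NAct.guess p), d) ∈ θ₁.Δ ∧
        θ₂.Δ = (θ₁.Δ \ {(q, TA.act (NAct.guess p), d)}) ∪ {(p, TA.topg, d')}) ∨
    -- store
    (∃ (p : Q) (d' : D), (q, TA.act (NAct.store p), d) ∈ θ₁.Δ ∧
        d' ∈ θ₁.rootData ∧
        θ₂.Δ = (θ₁.Δ \ {(q, TA.act (NAct.store p), d)}) ∪ {(p, TA.top, d')}) ∨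
    -- keep
    (∃ p : Q, (q, TA.act (NAct.keep p), d) ∈ θ₁.Δ ∧
        θ₂.Δ = (θ₁.Δ \ {(q, TA.act (NAct.keep p), d)}) ∪ {(p, TA.top, d)}) ∨
    -- accept
    ((q, TA.act NAct.accept, d) ∈ θ₁.Δ ∧
        θ₂.Δ = θ₁.Δ \ {(q, TA.act NAct.accept, d)}) ∨
    -- a (possibly negated) basic test, deleted if it holds
    (∃ (neg : Bool) (t : NTest Q S), (q, TA.test neg t, d) ∈ θ₁.Δ ∧
        taTestHolds θ₁ q d neg t ∧
        θ₂.Δ = θ₁.Δ \ {(q, TA.test neg t, d)}))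

/-- The transition `→inc(S, χ)`. -/
def incStep (Sq : Set (Q × TA Q S)) (χ : Set S) (θ₁ θ₂ : EConf A B Q S D h) :
    Prop :=
  (∃ d : D, θ₁.dfun d = Sq ∧ θ₁.gfun d = χ) ∧
  (∃ e₁ e₂ : D, e₁ ≠ e₂ ∧ θ₁.gfun e₁ = χ ∧ θ₁.gfun e₂ = χ) ∧
  ∃ e : D, e ∉ θ₁.dataset ∧ θ₂.r = θ₁.r ∧ θ₂.m = θ₁.m ∧
    (∀ d : D, d ≠ e → θ₂.dfun d = θ₁.dfun d ∧ θ₂.gfun d = θ₁.gfun d) ∧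
    θ₂.dfun e = {qa ∈ Sq | qa.2 ≠ TA.topg} ∧ θ₂.gfun e = χ

/-- The transition `→inc`. -/
def inc (θ₁ θ₂ : EConf A B Q S D h) : Prop :=
  ∃ (Sq : Set (Q × TA Q S)) (χ : Set S), incStep Sq χ θ₁ θ₂

/-- The transition `→grow`, adding a new root on top. -/
def growStep [Semigroup S] (θ₁ θ₂ : EConf A B Q S D h) : Prop :=
  θ₁.r = false ∧ θ₁.m = false ∧
  (∀ x ∈ θ₁.Δ, x.2.1 = TA.top ∨ x.2.1 = TA.topg) ∧
  θ₂.Δ = {x | x.2.1 = TA.bot ∧ ∃ α : TA Q S, (x.1, α, x.2.2) ∈ θ₁.Δ} ∧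
  ∃ (c : A × B) (d' : D),
    θ₂.Γ = {y | ∃ μ : S, ∃ e : D, (μ, e) ∈ θ₁.Γ ∧ y = (h c * μ, e)} ∪ {(h c, d')}

/-- The transition `→merge`, merging two extended configurations with the same
label and data value. -/
def mergeStep (θ₁ θ₂ θ₀ : EConf A B Q S D h) : Prop :=
  θ₁.rootInfo = θ₂.rootInfo ∧ θ₀.rootInfo = θ₁.rootInfo ∧
  θ₁.m = true ∧ θ₂.m = true ∧ θ₀.r = θ₁.r ∧ θ₁.r = θ₂.r ∧
  θ₀.Δ = θ₁.Δ ∪ θ₂.Δ ∧ θ₀.Γ = θ₁.Γ ∪ θ₂.Γ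

/-- Any single (ε-, inc- or grow-) transition step of the transition system. -/
def anyStep [Semigroup S] (δ : List (NTrans Q S)) (θ₁ θ₂ : EConf A B Q S D h) :
    Prop :=
  epsStep δ θ₁ θ₂ ∨ inc θ₁ θ₂ ∨ growStep θ₁ θ₂

/-- `Θ ⟹ θ`: one derivation step from a set of extended configurations. -/
def stepFrom [Semigroup S] (δ : List (NTrans Q S))
    (Θ : Set (EConf A B Q S D h)) (θ : EConf A B Q S D h) : Prop :=
  (∃ θ₁ ∈ Θ, anyStep δ θ₁ θ) ∨ ∃ θ₁ ∈ Θ, ∃ θ₂ ∈ Θ, mergeStep θ₁ θ₂ θ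

/-- `Θ ⟹⁺ θ`. -/
inductive Derives [Semigroup S] (δ : List (NTrans Q S)) :
    Set (EConf A B Q S D h) → EConf A B Q S D h → Prop where
  | base {Θ : Set (EConf A B Q S D h)} {θ : EConf A B Q S D h} :
      stepFrom δ Θ θ → Derives δ Θ θ
  | step {Θ : Set (EConf A B Q S D h)} {θ' θ : EConf A B Q S D h} :
      stepFrom δ Θ θ' → Derives δ (Θ ∪ {θ'}) θ → Derives δ Θ θ

/-- `Θ ⟹ⁿ θ`: derivation in at most `n` steps. -/
inductive DerivesN [Semigroup S] (δ : List (NTrans Q S)) :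
    ℕ → Set (EConf A B Q S D h) → EConf A B Q S D h → Prop where
  | base {n : ℕ} {Θ : Set (EConf A B Q S D h)} {θ : EConf A B Q S D h} :
      stepFrom δ Θ θ → DerivesN δ (n + 1) Θ θ
  | step {n : ℕ} {Θ : Set (EConf A B Q S D h)} {θ' θ : EConf A B Q S D h} :
      stepFrom δ Θ θ' → DerivesN δ n (Θ ∪ {θ'}) θ → DerivesN δ (n + 1) Θ θ

/-- `n`-fold composition of a binary relation. -/
def relPow {α : Type} (R : α → α → Prop) : ℕ → α → α → Prop
  | 0 => Eq
  | n + 1 => fun a c => ∃ b, R a b ∧ relPow R n b c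

/-- An initial extended configuration (abstracting a leaf). -/
def Initial (q0 : Q) (θ : EConf A B Q S D h) : Prop :=
  (∃ d : D, θ.Δ = {(q0, TA.bot, d)}) ∧
  ∃ (c : A × B) (d' : D), θ.Γ = {(h c, d')}

/-- An accepting extended configuration: no remaining threads. -/
def Accepting (θ : EConf A B Q S D h) : Prop := θ.Δ = ∅

theorem notMem_dataset (θ : EConf A B Q S D h) (d : D) :
    d ∉ θ.dataset ↔ θ.dfun d = ∅ ∧ θ.gfun d = ∅ := by
  simp only [EConf.dataset, EConf.dfun, EConf.gfun, Set.mem_setOf_eq, not_or, not_exists,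
    Set.eq_empty_iff_forall_notMem]

theorem dataset_finite (θ : EConf A B Q S D h) : θ.dataset.Finite := by
  refine ((θ.finΔ.image (fun x => x.2.2)).union (θ.finΓ.image (fun x => x.2))).subset ?_
  rintro d (⟨qa, hqa⟩ | ⟨μ, hμ⟩)
  · exact Or.inl ⟨_, hqa, rfl⟩
  · exact Or.inr ⟨_, hμ, rfl⟩

theorem empty_class_infinite [Infinite D] (θ : EConf A B Q S D h) :
    {d | θ.gfun d = ∅}.Infinite := by
  refine (dataset_finite θ).infinite_compl.mono ?_
  intro d hd
  exact ((notMem_dataset θ d).1 hd).2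

/-- Adding a fresh value. -/
theorem exists_add [Finite S] (θ : EConf A B Q S D h) (e d₀ e₁ e₂ : D) (he : e ∉ θ.dataset)
    (hne : e₁ ≠ e₂) (h₁ : θ.gfun e₁ = θ.gfun d₀) (h₂ : θ.gfun e₂ = θ.gfun d₀) :
    ∃ θ₁ : EConf A B Q S D h, θ₁.r = θ.r ∧ θ₁.m = θ.m ∧
      (∀ d : D, d ≠ e → θ₁.dfun d = θ.dfun d ∧ θ₁.gfun d = θ.gfun d) ∧
      θ₁.dfun e = {qa ∈ θ.dfun d₀ | qa.2 ≠ TA.topg} ∧ θ₁.gfun e = θ.gfun d₀ := by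
  obtain ⟨hd, hg⟩ := (notMem_dataset θ e).1 he
  have hd' : ∀ q a, (q, a, e) ∉ θ.Δ := fun q a hm => by
    have : (q, a) ∈ θ.dfun e := hm
    simp [hd] at this
  have hg' : ∀ μ, (μ, e) ∉ θ.Γ := fun μ hm => by
    have : μ ∈ θ.gfun e := hm
    simp [hg] at this
  have hχ : ∀ μ ∈ θ.gfun d₀, ∀ c, μ ≠ h c := by
    intro μ hμ c hc
    obtain ⟨x, -, hx⟩ := θ.uniq
    have a₁ := hx (μ, e₁) ⟨by rw [← h₁] at hμ; exact hμ, c, hc⟩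
    have a₂ := hx (μ, e₂) ⟨by rw [← h₂] at hμ; exact hμ, c, hc⟩
    have := a₁.trans a₂.symm
    simp only [Prod.mk.injEq, true_and] at this
    exact hne this
  have fd : (θ.dfun d₀).Finite := by
    refine (θ.finΔ.image (fun x => (x.1, x.2.1))).subset ?_
    intro qa hqa
    exact ⟨_, hqa, rfl⟩
  refine ⟨⟨θ.Δ ∪ (fun qa : Q × TA Q S => (qa.1, qa.2, e)) '' {qa ∈ θ.dfun d₀ | qa.2 ≠ TA.topg},
    θ.Γ ∪ (fun μ => (μ, e)) '' θ.gfun d₀, θ.r, θ.m,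
    θ.finΔ.union ((fd.subset (Set.sep_subset _ _)).image _),
    θ.finΓ.union ((Set.toFinite _).image _), ?_⟩, rfl, rfl, ?_, ?_, ?_⟩
  · obtain ⟨x, ⟨hx, hc⟩, hu⟩ := θ.uniq
    refine ⟨x, ⟨Or.inl hx, hc⟩, ?_⟩
    rintro y ⟨hy | ⟨μ, hμ, rfl⟩, c, hcy⟩
    · exact hu y ⟨hy, c, hcy⟩
    · exact absurd hcy (hχ μ hμ c)
  · intro d hde
    constructor
    · ext ⟨q, a⟩
      simp [EConf.dfun, Ne.symm hde]
    · ext μ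
      simp [EConf.gfun, Ne.symm hde]
  · ext ⟨q, a⟩
    simp [EConf.dfun, hd']
  · ext μ
    simp [EConf.gfun, hg']

theorem step_aux [Finite S] [Infinite D] (θ θ' : EConf A B Q S D h) (hle : ple θ' θ) (χ : Set S)
    (h2 : (2 : ℕ∞) < {d : D | θ.gfun d = χ}.encard)
    (h2' : ¬ (2 : ℕ∞) < {d : D | θ'.gfun d = χ}.encard) :
    ∃ θ₁ : EConf A B Q S D h, inc θ' θ₁ ∧ ple θ₁ θ ∧
      (2 : ℕ∞) < {d : D | θ₁.gfun d = χ}.encard ∧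
      ∀ χ' : Set S, (2 : ℕ∞) < {d : D | θ'.gfun d = χ'}.encard →
        (2 : ℕ∞) < {d : D | θ₁.gfun d = χ'}.encard := by
  classical
  obtain ⟨f, hprof, hrange, hf⟩ := hle
  have hχ : χ ≠ ∅ := by
    rintro rfl
    apply h2'
    rw [(empty_class_infinite θ').encard_eq]
    exact WithTop.coe_lt_top 2
  have hp0 : {d | θ'.gfun d = χ}.encard = 0 ↔ {d | θ.gfun d = χ}.encard = 0 :=
    Set.ext_iff.1 (congrArg (fun p => p.1) hprof) χ
  have hp1 : {d | θ'.gfun d = χ}.encard = 1 ↔ {d | θ.gfun d = χ}.encard = 1 :=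
    Set.ext_iff.1 (congrArg (fun p => p.2.1) hprof) χ
  have hr : θ'.r = θ.r := congrArg (fun p => p.2.2.1) hprof
  have hm : θ'.m = θ.m := congrArg (fun p => p.2.2.2) hprof
  have hc2 : {d | θ'.gfun d = χ}.encard = 2 := by
    have n0 : {d | θ'.gfun d = χ}.encard ≠ 0 := fun hh => by
      rw [hp0.1 hh] at h2; exact absurd h2 (by decide)
    have n1 : {d | θ'.gfun d = χ}.encard ≠ 1 := fun hh => by
      rw [hp1.1 hh] at h2; exact absurd h2 (by decide)
    generalize {d | θ'.gfun d = χ}.encard = c at *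
    have hle := not_lt.1 h2'
    lift c to ℕ using ne_top_of_le_ne_top (by decide) hle
    norm_cast at *
    omega
  -- pigeonhole
  obtain ⟨d₁, hd₁, d₂, hd₂, hne, hfe⟩ : ∃ d₁ ∈ {d | θ.gfun d = χ}, ∃ d₂ ∈ {d | θ.gfun d = χ},
      d₁ ≠ d₂ ∧ f d₁ = f d₂ := by
    by_contra! hcon
    have hinj : Set.InjOn f {d | θ.gfun d = χ} := by
      intro a ha b hb hab
      by_contra hne
      exact hcon a ha b hb hne hab
    have hle : (f '' {d | θ.gfun d = χ}).encard ≤ {d | θ'.gfun d = χ}.encard := by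
      apply Set.encard_le_encard
      rintro _ ⟨d, hd, rfl⟩
      exact (hf d).2.trans hd
    rw [hinj.encard_image, hc2] at hle
    exact absurd h2 (not_lt.2 hle)
  have hgχ : θ'.gfun (f d₁) = χ := (hf d₁).2.trans hd₁
  obtain ⟨e₁, e₂, hee, hE⟩ := Set.encard_eq_two.1 hc2
  have he₁ : θ'.gfun e₁ = χ := by
    have : e₁ ∈ {d | θ'.gfun d = χ} := by rw [hE]; simp
    exact this
  have he₂ : θ'.gfun e₂ = χ := by
    have : e₂ ∈ {d | θ'.gfun d = χ} := by rw [hE]; simp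
    exact this
  obtain ⟨e, he⟩ := (dataset_finite θ').exists_notMem
  obtain ⟨e', he'⟩ := ((dataset_finite θ').insert e).exists_notMem
  simp only [Set.mem_insert_iff, not_or] at he'
  obtain ⟨hee', he'⟩ := he'
  obtain ⟨hde, hge⟩ := (notMem_dataset θ' e).1 he
  obtain ⟨hde', hge'⟩ := (notMem_dataset θ' e').1 he'
  obtain ⟨θ₁, r1, m1, hoff, hdn, hgn⟩ := exists_add θ' e (f d₁) e₁ e₂ he hee
    (he₁.trans hgχ.symm) (he₂.trans hgχ.symm)
  rw [hgχ] at hgn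
  have hnew : {d | θ₁.gfun d = χ} = insert e {d | θ'.gfun d = χ} := by
    ext d
    by_cases hd : d = e
    · subst hd; simp [hgn]
    · simp [hd, (hoff d hd).2]
  have hnewc : {d | θ₁.gfun d = χ}.encard = 3 := by
    rw [hnew, Set.encard_insert_of_notMem, hc2]
    · norm_num
    · simp [hge, Ne.symm hχ]
  have hother : ∀ χ', χ' ≠ χ → χ' ≠ ∅ → {d | θ₁.gfun d = χ'} = {d | θ'.gfun d = χ'} := by
    intro χ' n1 n2
    ext d
    by_cases hd : d = e
    · subst hd; simp [hgn, hge, n1.symm, n2.symm]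
    · simp [(hoff d hd).2]
  have hemp : {d | θ₁.gfun d = ∅}.encard = {d | θ'.gfun d = ∅}.encard := by
    rw [(empty_class_infinite θ₁).encard_eq, (empty_class_infinite θ').encard_eq]
  have hother' : ∀ χ', χ' ≠ χ → {d | θ₁.gfun d = χ'}.encard = {d | θ'.gfun d = χ'}.encard := by
    intro χ' n1
    by_cases n2 : χ' = ∅
    · subst n2; exact hemp
    · rw [hother χ' n1 n2]
  have h23 : (2 : ℕ∞) < 3 := by decide
  refine ⟨θ₁, ⟨θ'.dfun (f d₁), χ, ⟨f d₁, rfl, hgχ⟩, ⟨e₁, e₂, hee, he₁, he₂⟩, e, he, r1, m1, hoff,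
    hdn, hgn⟩, ?_, by rw [hnewc]; exact h23, ?_⟩
  · refine ⟨fun d => if d = d₂ then e else if f d = e then e' else f d, ?_, ?_, ?_⟩
    · rw [← hprof]
      have k0 : ∀ χ', {d | θ₁.gfun d = χ'}.encard = 0 ↔ {d | θ'.gfun d = χ'}.encard = 0 := by
        intro χ'
        by_cases n1 : χ' = χ
        · subst n1; rw [hnewc, hc2]; decide
        · rw [hother' χ' n1]
      have k1 : ∀ χ', {d | θ₁.gfun d = χ'}.encard = 1 ↔ {d | θ'.gfun d = χ'}.encard = 1 := by
        intro χ'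
        by_cases n1 : χ' = χ
        · subst n1; rw [hnewc, hc2]; decide
        · rw [hother' χ' n1]
      simp only [EConf.profile, k0, k1, r1, m1]
    · intro d hd
      by_cases hde0 : d = e
      · exact ⟨d₂, by simp [hde0]⟩
      · have hd' : d ∈ θ'.dataset := by
          by_contra hcon
          obtain ⟨c1, c2⟩ := (notMem_dataset θ' d).1 hcon
          refine (notMem_dataset θ₁ d).2 ⟨?_, ?_⟩ hd
          · rw [(hoff d hde0).1, c1]
          · rw [(hoff d hde0).2, c2]
        obtain ⟨x, rfl⟩ := hrange hd'
        by_cases hx : x = d₂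
        · subst hx
          exact ⟨d₁, by simp [hne, hfe, hde0]⟩
        · exact ⟨x, by simp [hx, hde0]⟩
    · intro d
      by_cases hx : d = d₂
      · subst hx
        simp only [if_true]
        rw [hdn, hgn]
        refine ⟨?_, hd₂.symm⟩
        rw [hfe]
        exact (Set.sep_subset _ _).trans (hf d).1
      · by_cases hfd : f d = e
        · simp only [hx, hfd, if_true, if_false]
          rw [(hoff e' hee').1, (hoff e' hee').2, hde', hge', ← (hf d).2, hfd, hge]
          exact ⟨Set.empty_subset _, rfl⟩
        · simp only [hx, hfd, if_false]
          rw [(hoff _ hfd).1, (hoff _ hfd).2]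
          exact hf d
  · intro χ' hc
    by_cases n1 : χ' = χ
    · subst n1; exact absurd hc h2'
    · rw [hother' χ' n1]; exact hc

theorem augment_aux [Finite S] [Infinite D] (θ : EConf A B Q S D h) (k : ℕ) :
    ∀ θ' : EConf A B Q S D h, ple θ' θ →
    {χ : Set S | (2 : ℕ∞) < {d : D | θ.gfun d = χ}.encard ∧
        ¬ (2 : ℕ∞) < {d : D | θ'.gfun d = χ}.encard}.ncard ≤ k →
    ∃ (θt : EConf A B Q S D h) (n : ℕ),
      n ≤ k ∧ relPow inc n θ' θt ∧ ple θt θ ∧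
      ∀ χ : Set S,
        (2 : ℕ∞) < {d : D | θ.gfun d = χ}.encard →
        (2 : ℕ∞) < {d : D | θt.gfun d = χ}.encard := by
  induction k with
  | zero =>
    intro θ' hle hk
    refine ⟨θ', 0, le_rfl, rfl, hle, ?_⟩
    intro χ h2
    by_contra hcon
    have hemp := (Set.ncard_eq_zero (Set.toFinite _)).1 (Nat.le_zero.1 hk)
    exact Set.eq_empty_iff_forall_notMem.1 hemp χ ⟨h2, hcon⟩
  | succ k ih =>
    intro θ' hle hk
    by_cases hall : ∀ χ : Set S, (2 : ℕ∞) < {d : D | θ.gfun d = χ}.encard →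
        (2 : ℕ∞) < {d : D | θ'.gfun d = χ}.encard
    · exact ⟨θ', 0, Nat.zero_le _, rfl, hle, hall⟩
    · push Not at hall
      obtain ⟨χ, h2, h2'⟩ := hall
      obtain ⟨θ₁, hinc, hle₁, hχ, hmono⟩ := step_aux θ θ' hle χ h2 (not_lt.2 h2')
      obtain ⟨θt, n, hn, hrel, hlt, hfin⟩ := ih θ₁ hle₁ (by
        refine Nat.le_of_lt_succ (lt_of_lt_of_le (Set.ncard_lt_ncard ?_ (Set.toFinite _)) hk)
        refine ⟨fun χ' hc => ⟨hc.1, fun hh => hc.2 (hmono χ' hh)⟩, fun hsub => ?_⟩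
        exact (hsub (⟨h2, not_lt.2 h2'⟩ : χ ∈ {χ : Set S | _ ∧ _})).2 hχ)
      exact ⟨θt, n + 1, Nat.succ_le_succ hn, ⟨θ₁, hinc, hrel⟩, hlt, hfin⟩

/-- **Augmentation lemma (Lemma 3.8)**: if `θ' ⪯ θ` then some `θ̃` reachable
from `θ'` by at most `3·2^{|S|}` inc-steps satisfies `θ̃ ⪯ θ` and, for every
`χ ⊆ S`, if strictly more than two data values `d` of `θ` satisfy `Γ(d) = χ`,
then the same holds in `θ̃`. -/
theorem inc_augmentation (A B Q S D : Type) [Fintype A] [Fintype B] [Fintype Q]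
    [Fintype S] [Semigroup S] [Infinite D] (h : A × B → S) (hNF1 : NF1 h)
    (θ θ' : EConf A B Q S D h) (hle : ple θ' θ) :
    ∃ (θt : EConf A B Q S D h) (n : ℕ),
      n ≤ 3 * 2 ^ Fintype.card S ∧ relPow inc n θ' θt ∧ ple θt θ ∧
      ∀ χ : Set S,
        (2 : ℕ∞) < {d : D | θ.gfun d = χ}.encard →
        (2 : ℕ∞) < {d : D | θt.gfun d = χ}.encard := by
  obtain ⟨θt, n, hn, h1, h2, h3⟩ := augment_aux θ (2 ^ Fintype.card S) θ' hle (by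
    classical
    refine (Set.ncard_le_card _).trans ?_
    rw [Nat.card_eq_fintype_card, Fintype.card_set])
  exact ⟨θt, n, by omega, h1, h2, h3⟩

end ECBUDA
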